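/- arXiv:2603.01368 — 5 statements merged into one kernel-verified Lean document; each statement's English description precedes it below -/
import Mathlib

section
/- There exists a universal constant C > 0 such that for every integer n ≥ 1 and every integer c ≥ 0, the inversion walk on labelled tournaments on [n] satisfies d_n(n + c) ≤ C · 2^{−c}. -/
open scoped BigOperators

/-- Index type for the coordinates of `F_2^{C(n,2)}`: unordered pairs `{i,j} ⊆ [n]`,
represented as ordered pairs `(i,j)` with `i < j`. -/
def PairIdx (n : ℕ) := {p : Fin n × Fin n // p.1 < p.2}

instance (n : ℕ) : Fintype (PairIdx n) := by unfold PairIdx; infer_instance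
instance (n : ℕ) : DecidableEq (PairIdx n) := by unfold PairIdx; infer_instance

/-- The clique vector `v_X ∈ F_2^{C(n,2)}`: coordinate at `{i,j}` is `1` iff `{i,j} ⊆ X`. -/
def cliqueVec (n : ℕ) (X : Finset (Fin n)) : PairIdx n → ZMod 2 :=
  fun p => if p.1.1 ∈ X ∧ p.1.2 ∈ X then 1 else 0

/-- `μ_t(z)`: the distribution at time `t` of the inversion walk started at `0`, i.e. the
probability that `v_{X_1} + ⋯ + v_{X_t} = z` for i.i.d. uniform subsets `X_1,…,X_t ⊆ [n]`.
This equals the `t`-fold convolution power of the step distribution. -/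
noncomputable def invMu (n t : ℕ) (z : PairIdx n → ZMod 2) : ℝ :=
  ((Finset.univ.filter (fun Xs : Fin t → Finset (Fin n) =>
      ∑ i, cliqueVec n (Xs i) = z)).card : ℝ) / 2 ^ (n * t)

/-- `d_n(t)`: total-variation distance of `μ_t` from the uniform distribution on
`F_2^{C(n,2)}`. -/
noncomputable def invDist (n t : ℕ) : ℝ :=
  (1 / 2) * ∑ z : PairIdx n → ZMod 2, |invMu n t z - ((2 : ℝ) ^ n.choose 2)⁻¹|

open LinearMap (BilinForm)

section OrthogonalTuples

variable {V : Type*} [AddCommGroup V] [Module (ZMod 2) V] [Fintype V]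

open Classical in
/-- Tuples of pairwise `B`-orthogonal vectors, all of them `B`-orthogonal to `S`. The vectors may
fail to be orthogonal to themselves. -/
noncomputable def orthTuples (B : BilinForm (ZMod 2) V) (j : ℕ) (S : Submodule (ZMod 2) V) :
    Finset (Fin j → V) :=
  Finset.univ.filter fun f => (∀ i, f i ∈ B.orthogonal S) ∧ ∀ i k, i < k → B (f i) (f k) = 0

open Classical in
lemma card_orthTuples_succ_le (B : BilinForm (ZMod 2) V) (j : ℕ) (S : Submodule (ZMod 2) V) :
    (orthTuples B (j + 1) S).card ≤
      ∑ a ∈ Finset.univ.filter (· ∈ B.orthogonal S),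
        (orthTuples B j (S ⊔ Submodule.span (ZMod 2) {a})).card := by
  rw [← Finset.card_sigma]
  refine Finset.card_le_card_of_injOn (fun f => ⟨f 0, Fin.tail f⟩) ?_ ?_
  · intro f hf
    simp only [orthTuples, Finset.coe_filter, Finset.mem_univ, true_and, Set.mem_ofPred_eq] at hf
    simp only [orthTuples, Finset.coe_sigma, Set.mem_sigma_iff, Finset.coe_filter,
      Finset.mem_univ, true_and, Set.mem_ofPred_eq]
    refine ⟨hf.1 0, fun i => ?_, fun i k hik => hf.2 _ _ (Fin.succ_lt_succ_iff.2 hik)⟩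
    rw [LinearMap.BilinForm.mem_orthogonal_iff]
    intro x hx
    obtain ⟨y, hy, z, hz, rfl⟩ := Submodule.mem_sup.1 hx
    obtain ⟨c, rfl⟩ := Submodule.mem_span_singleton.1 hz
    have h₁ : B y (f i.succ) = 0 := (LinearMap.BilinForm.mem_orthogonal_iff.1 (hf.1 i.succ)) y hy
    have h₂ : B (f 0) (f i.succ) = 0 := hf.2 _ _ (Fin.succ_pos i)
    change B (y + c • f 0) (f i.succ) = 0
    simp [h₁, h₂]
  · intro f _ g _ h
    simp only [Sigma.mk.injEq, heq_eq_eq] at h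
    rw [← Fin.cons_self_tail f, ← Fin.cons_self_tail g, h.1, h.2]

open Classical in
lemma card_filter_mem_submodule (S : Submodule (ZMod 2) V) :
    (Finset.univ.filter (· ∈ S)).card = 2 ^ Module.finrank (ZMod 2) S := by
  rw [← Fintype.card_subtype, Module.card_eq_pow_finrank (K := ZMod 2) (V := S), ZMod.card]

lemma orthTuples_bound_step {s N p q u M : ℝ} (hs : 0 < s) (hN : 0 < N) (hp : 0 < p) (hq : 0 < q)
    (hu : 0 < u) (hM : 0 ≤ M) (h : s ^ 2 * u ^ 2 * 4 ≤ N) :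
    s * (M * (N + s ^ 2 * (u ^ 2 - u)) / (p * q * N)) +
        N / s * (M * (N + (s * 2) ^ 2 * (u ^ 2 - u)) / (p * u * q * N)) ≤
      M * N * (N + s ^ 2 * ((u * 2) ^ 2 - u * 2)) / (p * s * (u * q) * N) := by
  have key : M * N * (N + s ^ 2 * ((u * 2) ^ 2 - u * 2)) / (p * s * (u * q) * N) -
      (s * (M * (N + s ^ 2 * (u ^ 2 - u)) / (p * q * N)) +
        N / s * (M * (N + (s * 2) ^ 2 * (u ^ 2 - u)) / (p * u * q * N))) =
      M * s * (N - s ^ 2 * u ^ 2 + s ^ 2 * u) / (p * q * N) := by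
    field_simp
    ring
  have hpos : 0 ≤ N - s ^ 2 * u ^ 2 + s ^ 2 * u := by
    have h₁ : 0 ≤ s ^ 2 * u ^ 2 := by positivity
    have h₂ : 0 ≤ s ^ 2 * u := by positivity
    linarith
  rw [← sub_nonneg, key]
  positivity

lemma card_orthTuples_le {B : BilinForm (ZMod 2) V} (hB : B.Nondegenerate) (j : ℕ) :
    ∀ S : Submodule (ZMod 2) V,
      2 * Module.finrank (ZMod 2) S + 2 * j ≤ Module.finrank (ZMod 2) V →
      ((orthTuples B j S).card : ℝ) ≤
        (2 ^ Module.finrank (ZMod 2) V) ^ j *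
          (2 ^ Module.finrank (ZMod 2) V +
            (2 ^ Module.finrank (ZMod 2) S) ^ 2 * ((2 ^ j) ^ 2 - 2 ^ j)) /
          ((2 ^ Module.finrank (ZMod 2) S) ^ j * 2 ^ j.choose 2 *
            2 ^ Module.finrank (ZMod 2) V) := by
  classical
  induction j with
  | zero =>
    intro S _
    have h : (orthTuples B 0 S).card ≤ 1 := by
      simpa using Finset.card_le_univ (orthTuples B 0 S)
    simpa using h
  | succ j ih =>
    intro S hS
    have hI : ∀ a ∈ S, ((orthTuples B j (S ⊔ Submodule.span (ZMod 2) {a})).card : ℝ) ≤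
        (2 ^ Module.finrank (ZMod 2) V) ^ j *
          (2 ^ Module.finrank (ZMod 2) V +
            (2 ^ Module.finrank (ZMod 2) S) ^ 2 * ((2 ^ j) ^ 2 - 2 ^ j)) /
          ((2 ^ Module.finrank (ZMod 2) S) ^ j * 2 ^ j.choose 2 *
            2 ^ Module.finrank (ZMod 2) V) := fun a ha => by
      rw [sup_eq_left.2 ((Submodule.span_singleton_le_iff_mem a S).2 ha)]
      exact ih S (by lia)
    have hO : ∀ a ∉ S, ((orthTuples B j (S ⊔ Submodule.span (ZMod 2) {a})).card : ℝ) ≤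
        (2 ^ Module.finrank (ZMod 2) V) ^ j *
          (2 ^ Module.finrank (ZMod 2) V +
            (2 ^ (Module.finrank (ZMod 2) S + 1)) ^ 2 * ((2 ^ j) ^ 2 - 2 ^ j)) /
          ((2 ^ (Module.finrank (ZMod 2) S + 1)) ^ j * 2 ^ j.choose 2 *
            2 ^ Module.finrank (ZMod 2) V) := fun a ha => by
      have h := Submodule.finrank_sup_span_singleton ha
      rw [← h]
      exact ih _ (by lia)
    have hle : Module.finrank (ZMod 2) S ≤ Module.finrank (ZMod 2) V := Submodule.finrank_le S
    have hcI : (((Finset.univ.filter (· ∈ B.orthogonal S)).filter (· ∈ S)).card : ℝ) ≤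
        2 ^ Module.finrank (ZMod 2) S := by
      have : ((Finset.univ.filter (· ∈ B.orthogonal S)).filter (· ∈ S)).card ≤
          2 ^ Module.finrank (ZMod 2) S := by
        rw [← card_filter_mem_submodule S]
        exact Finset.card_le_card (Finset.filter_subset_filter _ (Finset.filter_subset _ _))
      exact_mod_cast this
    have hcO : (((Finset.univ.filter (· ∈ B.orthogonal S)).filter (· ∉ S)).card : ℝ) ≤
        2 ^ Module.finrank (ZMod 2) V / 2 ^ Module.finrank (ZMod 2) S := by
      have : ((Finset.univ.filter (· ∈ B.orthogonal S)).filter (· ∉ S)).card ≤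
          2 ^ (Module.finrank (ZMod 2) V - Module.finrank (ZMod 2) S) := by
        rw [← LinearMap.BilinForm.finrank_orthogonal hB, ← card_filter_mem_submodule]
        exact Finset.card_le_card (Finset.filter_subset _ _)
      rw [div_eq_mul_inv, ← pow_sub₀ _ two_ne_zero hle]
      exact_mod_cast this
    have hu : (1 : ℝ) ≤ 2 ^ j := one_le_pow₀ one_le_two
    have hN : (2 ^ Module.finrank (ZMod 2) S) ^ 2 * (2 ^ j) ^ 2 * 4 ≤
        (2 : ℝ) ^ Module.finrank (ZMod 2) V := by
      rw [← pow_mul, ← pow_mul, show (4 : ℝ) = 2 ^ 2 by norm_num, ← pow_add, ← pow_add]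
      exact pow_le_pow_right₀ one_le_two (by lia)
    have hsum : ((orthTuples B (j + 1) S).card : ℝ) ≤ _ :=
      Nat.cast_le.2 (card_orthTuples_succ_le B j S)
    refine hsum.trans ?_
    rw [← Finset.sum_filter_add_sum_filter_not _ (· ∈ S)]
    push_cast
    refine (add_le_add
      (Finset.sum_le_card_nsmul _ _ _ fun a ha => hI a (Finset.mem_filter.1 ha).2)
      (Finset.sum_le_card_nsmul _ _ _ fun a ha => hO a (Finset.mem_filter.1 ha).2)).trans ?_
    simp only [nsmul_eq_mul]
    have hd : (0 : ℝ) ≤ (2 ^ j) ^ 2 - 2 ^ j := by nlinarith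
    refine (add_le_add (mul_le_mul_of_nonneg_right hcI (by positivity))
      (mul_le_mul_of_nonneg_right hcO (by positivity))).trans ?_
    have hq : (j + 1).choose 2 = j + j.choose 2 := by
      rw [Nat.choose_succ_succ' j 1, Nat.choose_one_right]
    rw [hq]
    refine le_trans (le_of_eq ?_) ((orthTuples_bound_step (p := (2 ^ Module.finrank (ZMod 2) S) ^ j)
      (q := 2 ^ j.choose 2) (M := (2 ^ Module.finrank (ZMod 2) V) ^ j)
      (by positivity) (by positivity) (by positivity) (by positivity) (by positivity)
      (by positivity) hN).trans (le_of_eq ?_)) <;> ring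

end OrthogonalTuples

lemma card_pairIdx (n : ℕ) : Fintype.card (PairIdx n) = n.choose 2 := by
  unfold PairIdx
  let e : {p : Fin n × Fin n // p.1 < p.2} ≃ Σ j : Fin n, Fin j :=
    { toFun := fun p => ⟨p.1.2, ⟨p.1.1, p.2⟩⟩
      invFun := fun q => ⟨(⟨q.2, q.2.2.trans q.1.2⟩, q.1), q.2.2⟩
      left_inv := fun _ => rfl
      right_inv := fun _ => rfl }
  rw [Fintype.card_congr e, Fintype.card_sigma]
  simp only [Fintype.card_fin]
  rw [Fin.sum_univ_eq_sum_range fun i => i, Finset.sum_range_id, Nat.choose_two_right]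

/-- The tuple of `n` vectors over `F_2` whose `i`-th member records which of the given sets
contain `i`. -/
def incidenceRows {n : ℕ} {ι : Type*} (Z : ι → Finset (Fin n)) (i : Fin n) : ι → ZMod 2 :=
  fun k => if i ∈ Z k then 1 else 0

lemma incidenceRows_injective {n : ℕ} {ι : Type*} :
    Function.Injective (incidenceRows (n := n) (ι := ι)) := by
  intro Z W h
  funext k
  ext i
  have := congrFun (congrFun h i) k
  simp only [incidenceRows] at this
  split_ifs at this <;> simp_all

lemma dotProduct_incidenceRows {n : ℕ} {ι : Type*} [Fintype ι] (Z : ι → Finset (Fin n))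
    (p : PairIdx n) :
    incidenceRows Z p.1.1 ⬝ᵥ incidenceRows Z p.1.2 = ∑ k, cliqueVec n (Z k) p := by
  refine Finset.sum_congr rfl fun k _ => ?_
  simp only [incidenceRows, cliqueVec, ← ite_and, mul_ite, mul_one, mul_zero]
  split_ifs <;> simp_all

lemma sum_invMu (n t : ℕ) : ∑ z, invMu n t z = 1 := by
  simp only [invMu]
  rw [← Finset.sum_div, ← Nat.cast_sum,
    ← Finset.card_eq_sum_card_fiberwise (fun _ _ => Finset.mem_coe.2 (Finset.mem_univ _))]
  simp [pow_mul]

lemma sum_card_sq_le (n t : ℕ) :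
    ∑ z, (Finset.univ.filter (fun Xs : Fin t → Finset (Fin n) =>
      ∑ i, cliqueVec n (Xs i) = z)).card ^ 2 ≤
    (orthTuples (Matrix.toBilin' (1 : Matrix (Fin t ⊕ Fin t) (Fin t ⊕ Fin t) (ZMod 2))) n
      ⊥).card := by
  simp_rw [sq, ← Finset.card_product]
  rw [← Finset.card_sigma]
  refine Finset.card_le_card_of_injOn (fun q => incidenceRows (Sum.elim q.2.1 q.2.2)) ?_ ?_
  · rintro ⟨z, X, Y⟩ h
    simp only [Finset.coe_sigma, Set.mem_sigma_iff, Finset.mem_coe, Finset.mem_univ, true_and,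
      Finset.mem_product, Finset.mem_filter] at h
    simp only [orthTuples, Finset.coe_filter, Finset.mem_univ, true_and, Set.mem_ofPred_eq]
    refine ⟨fun i => by simp, fun i k hik => ?_⟩
    rw [Matrix.toBilin'_apply', Matrix.one_mulVec]
    refine (dotProduct_incidenceRows _ (⟨(i, k), hik⟩ : PairIdx n)).trans ?_
    have hX := congrFun h.1 ⟨(i, k), hik⟩
    have hY := congrFun h.2 ⟨(i, k), hik⟩
    replace hX := (Finset.sum_apply _ _ _).symm.trans hX
    replace hY := (Finset.sum_apply _ _ _).symm.trans hY
    simp [hX, hY, CharTwo.add_self_eq_zero]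
  · rintro ⟨z, X, Y⟩ h ⟨z', X', Y'⟩ h' heq
    simp only [Finset.coe_sigma, Set.mem_sigma_iff, Finset.mem_coe, Finset.mem_univ, true_and,
      Finset.mem_product, Finset.mem_filter] at h h'
    have := incidenceRows_injective heq
    have hX : X = X' := funext fun i => congrFun this (Sum.inl i)
    have hY : Y = Y' := funext fun i => congrFun this (Sum.inr i)
    subst hX hY
    obtain rfl : z = z' := h.1.symm.trans h'.1
    rfl

lemma sum_invMu_sq_le (n c : ℕ) :
    ∑ z, invMu n (n + c) z ^ 2 ≤ ((2 : ℝ) ^ n.choose 2)⁻¹ * (1 + ((2 : ℝ) ^ c)⁻¹ ^ 2) := by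
  have hB : (Matrix.toBilin'
      (1 : Matrix (Fin (n + c) ⊕ Fin (n + c)) (Fin (n + c) ⊕ Fin (n + c)) (ZMod 2))).Nondegenerate :=
    LinearMap.BilinForm.nondegenerate_toBilin'_of_det_ne_zero' _ (by simp)
  have h := card_orthTuples_le hB n ⊥ (by simp; lia)
  have h' : (_ : ℝ) ≤ _ := Nat.cast_le.2 (sum_card_sq_le n (n + c))
  have h'' := h'.trans h
  simp only [invMu, div_pow, ← Finset.sum_div]
  push_cast at h''
  refine (div_le_div_of_nonneg_right h'' (by positivity)).trans ?_
  simp only [finrank_bot, Module.finrank_fintype_fun_eq_card, Fintype.card_sum, Fintype.card_fin]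
  have hnc : (2 : ℝ) ^ (n + c + (n + c)) = (2 ^ n) ^ 2 * (2 ^ c) ^ 2 := by ring
  have hpow : (2 ^ (n * (n + c))) ^ 2 = ((2 : ℝ) ^ (n + c + (n + c))) ^ n := by ring
  rw [hpow, pow_zero, one_pow, one_pow]
  set K : ℝ := 2 ^ (n + c + (n + c))
  have hK : 0 < K := by positivity
  calc K ^ n * (K + 1 * ((2 ^ n) ^ 2 - 2 ^ n)) / (1 * 2 ^ n.choose 2 * K) / K ^ n
      = ((2 : ℝ) ^ n.choose 2)⁻¹ * (1 + ((2 ^ n) ^ 2 - 2 ^ n) / K) := by field_simp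
    _ ≤ ((2 : ℝ) ^ n.choose 2)⁻¹ * (1 + (2 ^ n) ^ 2 / K) := by
      gcongr
      exact sub_le_self _ (by positivity)
    _ = _ := by rw [hnc]; field_simp

/-- There is a universal constant `C > 0` such that for all `n ≥ 1` and all integers
`c ≥ 0`, the inversion walk satisfies `d_n(n + c) ≤ C · 2^{-c}`. -/
theorem inversion_walk_upper_tail :
    ∃ C : ℝ, 0 < C ∧ ∀ n : ℕ, 1 ≤ n → ∀ c : ℕ,
      invDist n (n + c) ≤ C * ((2 : ℝ) ^ c)⁻¹ := by
  refine ⟨1 / 2, by norm_num, fun n _ c => ?_⟩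
  unfold invDist
  gcongr
  refine le_of_sq_le_sq ?_ (by positivity)
  refine sq_sum_le_card_mul_sum_sq.trans ?_
  have hcard : (Finset.univ : Finset (PairIdx n → ZMod 2)).card = 2 ^ n.choose 2 := by
    rw [Finset.card_univ, Fintype.card_fun, card_pairIdx, ZMod.card]
  have hsq := sum_invMu_sq_le n c
  have hsum := sum_invMu n (n + c)
  have hexp : ∑ z, |invMu n (n + c) z - ((2 : ℝ) ^ n.choose 2)⁻¹| ^ 2 =
      ∑ z, invMu n (n + c) z ^ 2 - ((2 : ℝ) ^ n.choose 2)⁻¹ := by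
    simp only [sq_abs, sub_sq, Finset.sum_add_distrib, Finset.sum_sub_distrib, ← Finset.sum_mul,
      ← Finset.mul_sum, hsum, Finset.sum_const, hcard, nsmul_eq_mul]
    push_cast
    field_simp
    ring
  rw [hexp, hcard]
  push_cast
  set M : ℝ := 2 ^ n.choose 2
  have hM : 0 < M := by positivity
  calc M * (∑ z, invMu n (n + c) z ^ 2 - M⁻¹)
      ≤ M * (M⁻¹ * (1 + ((2 : ℝ) ^ c)⁻¹ ^ 2) - M⁻¹) := by gcongr
    _ = ((2 : ℝ) ^ c)⁻¹ ^ 2 := by field_simp; ring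
end

section
/- For every n ≥ 1 and every A ∈ F_2^{C(n,2)} (coordinates indexed by unordered pairs {i,j} ⊆ [n]), one has |Σ_{X ⊆ [n]} (−1)^{e_A(X)}| ≤ 2^{n − r(A)/2}, where e_A(X) ∈ F_2 is the parity of the number of pairs {i,j} ⊆ X with A_{{i,j}} = 1, the sum ranges over all 2^n subsets X of [n], is taken in the real numbers, and r(A) is the rank over F_2 of the symmetric n×n matrix M_A with zero diagonal and (i,j)-entry A_{{i,j}} for i ≠ j. Equivalently, every Fourier eigenvalue λ_A of the inversion walk satisfies |λ_A| ≤ 2^{−r(A)/2}. -/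
open scoped BigOperators

/-- The symmetric `n × n` matrix `M_A` over `F_2` with zero diagonal whose `(i,j)`-entry
for `i ≠ j` is the coordinate of `A` at `{i,j}`; `r(A) := rank_{F_2}(M_A)`. -/
def matA (n : ℕ) (A : PairIdx n → ZMod 2) : Matrix (Fin n) (Fin n) (ZMod 2) :=
  Matrix.of fun i j =>
    if h : i < j then A ⟨(i, j), h⟩ else if h : j < i then A ⟨(j, i), h⟩ else 0

/-- The nontrivial real character of `F_2`. -/
noncomputable def signChar (a : ZMod 2) : ℝ := if a = 0 then 1 else -1

lemma signChar_add (a b : ZMod 2) : signChar (a + b) = signChar a * signChar b := by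
  have two_eq (c : ZMod 2) : c = 0 ∨ c = 1 := by revert c; decide
  have h : (1 + 1 : ZMod 2) = 0 := by decide
  rcases two_eq a with rfl | rfl <;> rcases two_eq b with rfl | rfl <;> simp [signChar, h]

lemma abs_signChar (a : ZMod 2) : |signChar a| = 1 := by
  unfold signChar
  split_ifs <;> simp

lemma signChar_of_ne_zero {a : ZMod 2} (ha : a ≠ 0) : signChar a = -1 := by
  simp [signChar, ha]

lemma sum_signChar_dotProduct_eq_zero {ι : Type*} [Fintype ι] [DecidableEq ι] {v : ι → ZMod 2}
    (hv : v ≠ 0) : ∑ x : ι → ZMod 2, signChar (x ⬝ᵥ v) = 0 := by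
  obtain ⟨i, hi⟩ := Function.ne_iff.mp hv
  have h : ∑ x : ι → ZMod 2, signChar (x ⬝ᵥ v) = -∑ x : ι → ZMod 2, signChar (x ⬝ᵥ v) := by
    rw [← Finset.sum_neg_distrib]
    refine (Equiv.sum_comp (Equiv.addRight (Pi.single i (1 : ZMod 2))) _).symm.trans
      (Finset.sum_congr rfl fun x _ => ?_)
    rw [Equiv.coe_addRight, add_dotProduct, single_dotProduct, one_mul, signChar_add,
      signChar_of_ne_zero hi, mul_neg_one]
  linarith

lemma card_ker_mulVecLin_mul_two_pow_rank {ι : Type*} [Fintype ι] [DecidableEq ι]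
    (M : Matrix ι ι (ZMod 2)) :
    Fintype.card {y : ι → ZMod 2 // M.mulVec y = 0} * 2 ^ M.rank = 2 ^ Fintype.card ι := by
  have h := M.mulVecLin.finrank_range_add_finrank_ker
  rw [Module.finrank_fintype_fun_eq_card] at h
  have hc : Nat.card (LinearMap.ker M.mulVecLin) =
      Fintype.card {y : ι → ZMod 2 // M.mulVec y = 0} := by
    rw [← Nat.card_eq_fintype_card]
    exact Nat.card_congr (Equiv.subtypeEquivRight fun y => by simp)
  rw [← hc, Module.natCard_eq_pow_finrank (K := ZMod 2), Nat.card_zmod, ← pow_add, Matrix.rank,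
    add_comm, h]

/-- The squared Gauss sum of a function on `F_2^ι` with polarization `x ⬝ᵥ M y`. -/
lemma sq_sum_signChar_le {ι : Type*} [Fintype ι] [DecidableEq ι] (M : Matrix ι ι (ZMod 2))
    (q : (ι → ZMod 2) → ZMod 2) (hq : ∀ x y, q (x + y) = q x + q y + x ⬝ᵥ M.mulVec y) :
    (∑ x, signChar (q x)) ^ 2 ≤
      2 ^ Fintype.card ι * Fintype.card {y : ι → ZMod 2 // M.mulVec y = 0} := by
  have key : (∑ x, signChar (q x)) ^ 2 =
      ∑ y, signChar (q y) * ∑ x, signChar (x ⬝ᵥ M.mulVec y) := by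
    simp_rw [Finset.mul_sum]
    rw [sq, Finset.sum_mul_sum, Finset.sum_comm (γ := ι → ZMod 2)
      (f := fun y x => signChar (q y) * signChar (x ⬝ᵥ M.mulVec y))]
    refine Finset.sum_congr rfl fun x _ => ?_
    refine (Equiv.sum_comp (Equiv.addLeft x) _).symm.trans (Finset.sum_congr rfl fun y _ => ?_)
    rw [Equiv.coe_addLeft, ← signChar_add, ← signChar_add, hq, ← add_assoc, ← add_assoc,
      CharTwo.add_self_eq_zero, zero_add]
  have hterm (y : ι → ZMod 2) : signChar (q y) * ∑ x, signChar (x ⬝ᵥ M.mulVec y) ≤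
      if M.mulVec y = 0 then 2 ^ Fintype.card ι else 0 := by
    split_ifs with hy
    · have hle : signChar (q y) ≤ 1 := (le_abs_self _).trans (abs_signChar _).le
      have hsum : ∑ x : ι → ZMod 2, signChar (x ⬝ᵥ M.mulVec y) = 2 ^ Fintype.card ι := by
        simp [hy, signChar, ZMod.card]
      rw [hsum]
      exact mul_le_of_le_one_left (by positivity) hle
    · rw [sum_signChar_dotProduct_eq_zero hy, mul_zero]
  rw [key]
  refine (Finset.sum_le_sum fun y _ => hterm y).trans_eq ?_
  rw [← Finset.sum_filter, Finset.sum_const, nsmul_eq_mul, mul_comm, Fintype.card_subtype]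

lemma abs_sum_signChar_le {ι : Type*} [Fintype ι] [DecidableEq ι] (M : Matrix ι ι (ZMod 2))
    (q : (ι → ZMod 2) → ZMod 2) (hq : ∀ x y, q (x + y) = q x + q y + x ⬝ᵥ M.mulVec y) :
    |∑ x, signChar (q x)| ≤ (2 : ℝ) ^ ((Fintype.card ι : ℝ) - (M.rank : ℝ) / 2) := by
  have hk : (Fintype.card {y : ι → ZMod 2 // M.mulVec y = 0} : ℝ) * 2 ^ M.rank =
      2 ^ Fintype.card ι := mod_cast card_ker_mulVecLin_mul_two_pow_rank M
  refine abs_le_of_sq_le_sq ?_ (by positivity)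
  refine (sq_sum_signChar_le M q hq).trans_eq ?_
  rw [eq_div_of_mul_eq (by positivity) hk, ← Real.rpow_natCast _ 2, ← Real.rpow_mul zero_le_two]
  simp_rw [← Real.rpow_natCast (2 : ℝ)]
  rw [← Real.rpow_sub zero_lt_two, ← Real.rpow_add zero_lt_two]
  congr 1
  push_cast
  ring

/-- The quadratic form `x ↦ ∑_{i<j} A_{ij} x_i x_j` over `F_2`. -/
def pairForm (n : ℕ) (A : PairIdx n → ZMod 2) (x : Fin n → ZMod 2) : ZMod 2 :=
  ∑ p : PairIdx n, A p * (x p.1.1 * x p.1.2)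

lemma sum_pairIdx {n : ℕ} (A : PairIdx n → ZMod 2) (f : Fin n → Fin n → ZMod 2) :
    ∑ p : PairIdx n, A p * f p.1.1 p.1.2 =
      ∑ i, ∑ j, if i < j then matA n A i j * f i j else 0 := by
  rw [← Fintype.sum_prod_type' (f := fun i j => if i < j then matA n A i j * f i j else 0),
    ← Finset.sum_filter, Finset.sum_subtype (p := fun p : Fin n × Fin n => p.1 < p.2) _ (by simp)]
  refine Finset.sum_congr rfl fun p _ => ?_
  have hp : p.1.1 < p.1.2 := p.2
  simp only [matA, Matrix.of_apply, dif_pos hp]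
  rfl

lemma matA_comm {n : ℕ} (A : PairIdx n → ZMod 2) (i j : Fin n) : matA n A i j = matA n A j i := by
  rcases lt_trichotomy i j with h | rfl | h
  · simp [matA, h, h.not_gt]
  · rfl
  · simp [matA, h, h.not_gt]

lemma matA_self {n : ℕ} (A : PairIdx n → ZMod 2) (i : Fin n) : matA n A i i = 0 := by
  simp [matA]

lemma pairForm_add {n : ℕ} (A : PairIdx n → ZMod 2) (x y : Fin n → ZMod 2) :
    pairForm n A (x + y) =
      pairForm n A x + pairForm n A y + x ⬝ᵥ (matA n A).mulVec y := by
  have hpolar : ∑ p : PairIdx n, A p * (x p.1.1 * y p.1.2) +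
      ∑ p : PairIdx n, A p * (x p.1.2 * y p.1.1) = x ⬝ᵥ (matA n A).mulVec y := by
    rw [sum_pairIdx A fun i j => x i * y j, sum_pairIdx A fun i j => x j * y i,
      Finset.sum_comm (f := fun i j => if i < j then matA n A i j * (x j * y i) else 0),
      ← Finset.sum_add_distrib]
    refine Finset.sum_congr rfl fun i _ => ?_
    rw [Matrix.mulVec, dotProduct, Finset.mul_sum, ← Finset.sum_add_distrib]
    refine Finset.sum_congr rfl fun j _ => ?_
    rcases lt_trichotomy i j with h | rfl | h
    · rw [if_pos h, if_neg h.not_gt]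
      ring
    · simp [matA_self]
    · rw [if_neg h.not_gt, if_pos h, matA_comm A j i]
      ring
  rw [← hpolar]
  simp only [pairForm, ← Finset.sum_add_distrib, Pi.add_apply]
  exact Finset.sum_congr rfl fun p _ => by ring

/-- Subsets correspond to their indicator vectors over `F_2`. -/
def indicatorEquiv (ι : Type*) [Fintype ι] [DecidableEq ι] : Finset ι ≃ (ι → ZMod 2) where
  toFun X i := if i ∈ X then 1 else 0
  invFun x := {i | x i = 1}
  left_inv X := by ext i; simp
  right_inv x := by
    have two_eq (c : ZMod 2) : (if c = 1 then 1 else 0) = c := by revert c; decide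
    ext1 i
    simpa using two_eq (x i)

/-- For every `n ≥ 1` and `A ∈ F_2^{C(n,2)}`,
`|Σ_{X ⊆ [n]} (-1)^{e_A(X)}| ≤ 2^{n - r(A)/2}`, where `e_A(X)` is the parity of the
number of pairs `{i,j} ⊆ X` with `A_{{i,j}} = 1`. Equivalently, the Fourier eigenvalue
`λ_A = 2^{-n} Σ_X (-1)^{e_A(X)}` of the inversion walk satisfies `|λ_A| ≤ 2^{-r(A)/2}`. -/
theorem eigenvalue_rank_bound (n : ℕ) (hn : 1 ≤ n) (A : PairIdx n → ZMod 2) :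
    |∑ X : Finset (Fin n),
        (if (∑ p : PairIdx n, (if p.1.1 ∈ X ∧ p.1.2 ∈ X then A p else 0)) = (0 : ZMod 2)
          then (1 : ℝ) else -1)| ≤
      (2 : ℝ) ^ ((n : ℝ) - ((matA n A).rank : ℝ) / 2) := by
  have h := abs_sum_signChar_le (matA n A) (pairForm n A) (pairForm_add A)
  rw [Fintype.card_fin, ← Equiv.sum_comp (indicatorEquiv (Fin n))] at h
  convert h using 4 with X
  simp only [signChar, pairForm, indicatorEquiv, Equiv.coe_fn_mk, ← ite_and, mul_ite, mul_one,
    mul_zero, and_comm]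
end

section
/- For every n ≥ 1 and every integer c ≥ 0, Σ_{A ∈ F_2^{C(n,2)}, A ≠ 0} 2^{−r(A)(n+c)} ≤ 2^{−2c}, where the sum is over all nonzero A ∈ F_2^{C(n,2)} and is taken in the real numbers. -/
open scoped BigOperators

/-- Deleting a column that is not in the span of the others lowers the rank. -/
theorem rank_submatrix_succ_lt {K m : Type*} [Field K] [Fintype m] {n : ℕ}
    (P : Matrix m (Fin (n + 1)) K)
    (h : P.col 0 ∉ LinearMap.range (P.submatrix id Fin.succ).mulVecLin) :
    (P.submatrix id Fin.succ).rank < P.rank := by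
  apply Submodule.finrank_lt_finrank_of_lt
  refine lt_of_le_of_ne ?_ fun heq => h ?_
  · rintro _ ⟨x, rfl⟩
    refine ⟨Fin.cons 0 x, ?_⟩
    ext i
    simp [Matrix.mulVec, dotProduct, Fin.sum_univ_succ]
  · rw [heq]
    exact ⟨Pi.single 0 1, by simp⟩

/-- The coordinates of `A` at the pairs avoiding the first vertex. -/
def pairTail {n : ℕ} (A : PairIdx (n + 1) → ZMod 2) : PairIdx n → ZMod 2 :=
  fun p => A ⟨(p.1.1.succ, p.1.2.succ), Fin.succ_lt_succ_iff.2 p.2⟩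

/-- The coordinates of `A` at the pairs containing the first vertex. -/
def pairHead {n : ℕ} (A : PairIdx (n + 1) → ZMod 2) : Fin n → ZMod 2 :=
  fun j => A ⟨(0, j.succ), Fin.succ_pos j⟩

theorem pairTail_pairHead_injective (n : ℕ) :
    Function.Injective fun A : PairIdx (n + 1) → ZMod 2 => (pairTail A, pairHead A) := by
  intro A B h
  obtain ⟨h₁, h₂⟩ := Prod.ext_iff.1 h
  funext ⟨⟨i, j⟩, hij⟩
  obtain ⟨j, rfl⟩ := Fin.exists_succ_eq.2 (Fin.pos_iff_ne_zero.1 (lt_of_le_of_lt i.zero_le hij))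
  cases i using Fin.cases with
  | zero => exact congrFun h₂ j
  | succ i => exact congrFun h₁ ⟨(i, j), Fin.succ_lt_succ_iff.1 hij⟩

theorem matA_zero (n : ℕ) : matA n 0 = 0 := by
  ext i j
  simp only [matA, Matrix.of_apply, Matrix.zero_apply]
  split_ifs <;> rfl

theorem matA_transpose (n : ℕ) (A : PairIdx n → ZMod 2) : (matA n A).transpose = matA n A := by
  ext i j
  rcases lt_trichotomy i j with h | rfl | h <;> simp [matA, *, not_lt_of_gt]

theorem matA_submatrix_succ {n : ℕ} (A : PairIdx (n + 1) → ZMod 2) :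
    (matA (n + 1) A).submatrix Fin.succ Fin.succ = matA n (pairTail A) := by
  ext i j
  simp [matA, pairTail]

theorem matA_succ_zero {n : ℕ} (A : PairIdx (n + 1) → ZMod 2) (i : Fin n) :
    matA (n + 1) A i.succ 0 = pairHead A i := by
  simp [matA, pairHead]

theorem matA_zero_succ {n : ℕ} (A : PairIdx (n + 1) → ZMod 2) (i : Fin n) :
    matA (n + 1) A 0 i.succ = pairHead A i := by
  simp [matA, pairHead]

theorem transpose_submatrix_transpose_submatrix {n : ℕ} (A : PairIdx (n + 1) → ZMod 2) :
    ((matA (n + 1) A).submatrix id Fin.succ).transpose.submatrix id Fin.succ =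
      matA n (pairTail A) := by
  rw [Matrix.transpose_submatrix, matA_transpose, Matrix.submatrix_submatrix]
  exact matA_submatrix_succ A

theorem rank_pairTail_le {n : ℕ} (A : PairIdx (n + 1) → ZMod 2) :
    (matA n (pairTail A)).rank ≤ (matA (n + 1) A).rank := by
  rw [← matA_submatrix_succ]
  exact Matrix.rank_submatrix_le _ _ _

theorem rank_pairTail_add_two_le {n : ℕ} (A : PairIdx (n + 1) → ZMod 2)
    (h : pairHead A ∉ LinearMap.range (matA n (pairTail A)).mulVecLin) :
    (matA n (pairTail A)).rank + 2 ≤ (matA (n + 1) A).rank := by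
  have h₁ : ((matA (n + 1) A).submatrix id Fin.succ).rank < (matA (n + 1) A).rank := by
    apply rank_submatrix_succ_lt
    rintro ⟨x, hx⟩
    refine h ⟨x, ?_⟩
    ext i
    have := congrFun hx i.succ
    rw [← matA_submatrix_succ]
    simpa [Matrix.mulVec, Matrix.col, dotProduct, matA_succ_zero] using this
  have h₂ := rank_submatrix_succ_lt ((matA (n + 1) A).submatrix id Fin.succ).transpose (by
    rw [transpose_submatrix_transpose_submatrix]
    exact fun hmem => h (by
      convert hmem using 1
      ext i
      simp [Matrix.col, matA_zero_succ]))
  rw [transpose_submatrix_transpose_submatrix, Matrix.rank_transpose] at h₂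
  omega

theorem two_le_rank_matA {n : ℕ} {A : PairIdx n → ZMod 2} (hA : A ≠ 0) :
    2 ≤ (matA n A).rank := by
  induction n with
  | zero => exact absurd (funext fun p => p.1.1.elim0) hA
  | succ n ih =>
    by_cases h : pairTail A = 0
    · have h' : pairHead A ≠ 0 := fun h' =>
        hA (pairTail_pairHead_injective n (Prod.ext h h'))
      refine le_trans (Nat.le_add_left _ _) (rank_pairTail_add_two_le A ?_)
      rintro ⟨x, hx⟩
      refine h' (hx.symm.trans ?_)
      simp [h, matA_zero]
    · exact (ih h).trans (rank_pairTail_le A)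

theorem sum_pow_rank_succ_le (n : ℕ) :
    ∑ A : PairIdx (n + 1) → ZMod 2, (2⁻¹ : ℝ) ^ ((matA (n + 1) A).rank * (n + 1)) ≤
      (1 + 2⁻¹ ^ (n + 2)) * ∑ A : PairIdx n → ZMod 2, (2⁻¹ : ℝ) ^ ((matA n A).rank * n) := by
  classical
  let g : (PairIdx n → ZMod 2) × (Fin n → ZMod 2) → ℝ := fun q =>
    if q.2 ∈ LinearMap.range (matA n q.1).mulVecLin then 2⁻¹ ^ ((matA n q.1).rank * (n + 1))
    else 2⁻¹ ^ (((matA n q.1).rank + 2) * (n + 1))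
  have hg : ∀ q, 0 ≤ g q := fun q => by simp only [g]; split_ifs <;> positivity
  calc
    _ ≤ ∑ A : PairIdx (n + 1) → ZMod 2, g (pairTail A, pairHead A) := by
      refine Finset.sum_le_sum fun A _ => ?_
      simp only [g]
      split_ifs with h
      · exact pow_le_pow_of_le_one (by norm_num) (by norm_num)
          (Nat.mul_le_mul_right _ (rank_pairTail_le A))
      · exact pow_le_pow_of_le_one (by norm_num) (by norm_num)
          (Nat.mul_le_mul_right _ (rank_pairTail_add_two_le A h))
    _ ≤ ∑ q, g q := by
      rw [← Finset.sum_image (f := g) (g := fun A => (pairTail A, pairHead A))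
        (pairTail_pairHead_injective n).injOn]
      exact Finset.sum_le_sum_of_subset_of_nonneg (Finset.subset_univ _) fun q _ _ => hg q
    _ ≤ _ := by
      rw [Fintype.sum_prod_type, Finset.mul_sum]
      refine Finset.sum_le_sum fun A _ => ?_
      simp only [g]
      set r := (matA n A).rank with hr
      have hcard : (Finset.univ.filter fun v =>
          v ∈ LinearMap.range (matA n A).mulVecLin).card = 2 ^ r := by
        rw [← Fintype.card_subtype, hr, Matrix.rank]
        simpa using Module.card_eq_pow_finrank (K := ZMod 2)
          (V := LinearMap.range (matA n A).mulVecLin)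
      have hcard' : ((Finset.univ.filter fun v =>
          v ∉ LinearMap.range (matA n A).mulVecLin).card : ℝ) ≤ 2 ^ n := by
        exact_mod_cast (Finset.card_le_univ _).trans (by simp)
      rw [Finset.sum_ite, Finset.sum_const, Finset.sum_const, hcard, nsmul_eq_mul, nsmul_eq_mul]
      have key : ∀ k : ℕ, (2 : ℝ) ^ k * 2⁻¹ ^ k = 1 := fun k => by rw [← mul_pow]; norm_num
      have h₁ : ((2 ^ r : ℕ) : ℝ) * 2⁻¹ ^ (r * (n + 1)) = 2⁻¹ ^ (r * n) := by
        push_cast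
        rw [show r * (n + 1) = r + r * n by ring, pow_add, ← mul_assoc, key, one_mul]
      have h₂ : (2 : ℝ) ^ n * 2⁻¹ ^ ((r + 2) * (n + 1)) ≤ 2⁻¹ ^ (n + 2) * 2⁻¹ ^ (r * n) := by
        rw [show (r + 2) * (n + 1) = n + ((n + 2 + r * n) + r) by ring, pow_add, ← mul_assoc, key,
          one_mul, ← pow_add]
        exact pow_le_pow_of_le_one (by norm_num) (by norm_num) (Nat.le_add_right _ _)
      have h₃ := mul_le_mul_of_nonneg_right hcard'
        (show (0 : ℝ) ≤ 2⁻¹ ^ ((r + 2) * (n + 1)) by positivity)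
      linarith

theorem sum_pow_rank_le (n : ℕ) :
    ∑ A : PairIdx n → ZMod 2, (2⁻¹ : ℝ) ^ ((matA n A).rank * n) ≤ 2 - 2⁻¹ ^ n := by
  induction n with
  | zero =>
    have : IsEmpty (PairIdx 0) := ⟨fun p => p.1.1.elim0⟩
    norm_num
  | succ n ih =>
    refine (sum_pow_rank_succ_le n).trans
      ((mul_le_mul_of_nonneg_left ih (by positivity)).trans ?_)
    have : (0 : ℝ) < 2⁻¹ ^ n := by positivity
    rw [pow_add _ n 2, pow_succ _ n]
    nlinarith

/-- For every `n ≥ 1` and every integer `c ≥ 0`,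
`Σ_{A ≠ 0} 2^{-r(A)(n+c)} ≤ 2^{-2c}`. -/
theorem rank_sum_upper (n : ℕ) (hn : 1 ≤ n) (c : ℕ) :
    ∑ A ∈ Finset.univ.filter (fun A : PairIdx n → ZMod 2 => A ≠ 0),
        ((2 : ℝ)⁻¹) ^ ((matA n A).rank * (n + c)) ≤ ((2 : ℝ)⁻¹) ^ (2 * c) := by
  calc
    _ ≤ ∑ A ∈ Finset.univ.filter (fun A : PairIdx n → ZMod 2 => A ≠ 0),
        (2 : ℝ)⁻¹ ^ (2 * c) * 2⁻¹ ^ ((matA n A).rank * n) := by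
      refine Finset.sum_le_sum fun A hA => ?_
      rw [← pow_add]
      refine pow_le_pow_of_le_one (by norm_num) (by norm_num) ?_
      nlinarith [Nat.mul_le_mul_right c (two_le_rank_matA (Finset.mem_filter.1 hA).2)]
    _ = 2⁻¹ ^ (2 * c) * (∑ A : PairIdx n → ZMod 2, (2⁻¹ : ℝ) ^ ((matA n A).rank * n) - 1) := by
      rw [← Finset.mul_sum, Finset.filter_ne', ← Finset.add_sum_erase _ _ (Finset.mem_univ 0),
        matA_zero]
      simp
    _ ≤ _ := by
      have h := sum_pow_rank_le n
      have : (0 : ℝ) < 2⁻¹ ^ n := by positivity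
      exact mul_le_of_le_one_right (by positivity) (by linarith)
end

section
/- For every n ≥ 1 and every integer s with 0 ≤ s ≤ n, the number of symmetric n×n matrices M over F_2 with rank_{F_2}(M) ≤ n − s is at most 2^{C(n,2)+n} · n^s · 2^{−C(s,2)}. Equivalently, a uniformly random symmetric n×n matrix over F_2 satisfies Pr(rank ≤ n − s) ≤ n^s · 2^{−C(s,2)}. -/
open scoped BigOperators Classical

/-- The rows of `M` indexed outside `T` span its row space. -/
def Matrix.RowsSpannedOutside {ι K : Type*} [Field K] (M : Matrix ι ι K) (T : Finset ι) : Prop :=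
  ∀ i, M.row i ∈ Submodule.span K (M.row '' {k | k ∉ T})

theorem Matrix.exists_rowsSpannedOutside {ι K : Type*} [Fintype ι] [Field K]
    (M : Matrix ι ι K) {s : ℕ} (hs : s ≤ Fintype.card ι) (hM : M.rank ≤ Fintype.card ι - s) :
    ∃ T : Finset ι, T.card = s ∧ M.RowsSpannedOutside T := by
  obtain ⟨κ, a, ha, hspan, hli⟩ := exists_linearIndependent' K M.row
  have : Fintype κ := Fintype.ofInjective a ha
  have hcard : (Finset.univ.image a).card = M.rank := by
    rw [Finset.card_image_of_injective _ ha, Finset.card_univ, M.rank_eq_finrank_span_row, ← hspan,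
      finrank_span_eq_card hli]
  obtain ⟨T, hT, hTs⟩ := Finset.exists_subset_card_eq
    (s := (Finset.univ.image a)ᶜ) (n := s) (by rw [Finset.card_compl]; omega)
  refine ⟨T, hTs, fun i => ?_⟩
  have hi : M.row i ∈ Submodule.span K (Set.range (M.row ∘ a)) :=
    hspan ▸ Submodule.subset_span ⟨i, rfl⟩
  refine Submodule.span_mono ?_ hi
  rintro _ ⟨k, rfl⟩
  exact ⟨a k, fun hk => by simpa using hT hk, rfl⟩

theorem Matrix.RowsSpannedOutside.exists_coeff {ι K : Type*} [Fintype ι] [Field K]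
    {M : Matrix ι ι K} {T : Finset ι} (h : M.RowsSpannedOutside T) (i : ι) :
    ∃ c : ι → K, ∀ j, M i j = ∑ k ∈ Tᶜ, c k * M k j := by
  have hi := h i
  rw [show {k | k ∉ T} = ((Tᶜ : Finset ι) : Set ι) by ext; simp,
    Submodule.mem_span_image_finset_iff_exists_fun'] at hi
  obtain ⟨c, hc⟩ := hi
  exact ⟨c, fun j => by simpa [Finset.sum_apply] using (congrFun hc j).symm⟩

/-- Two matrices, one of them symmetric, whose row spaces are spanned by the rows outside `T`
are equal as soon as they agree outside the `T × T` block. -/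
theorem Matrix.RowsSpannedOutside.eq_of_eq_off_block {ι K : Type*} [Fintype ι] [Field K]
    {M N : Matrix ι ι K} {T : Finset ι} (hN : N.IsSymm)
    (hMT : M.RowsSpannedOutside T) (hNT : N.RowsSpannedOutside T)
    (h : ∀ i j, ¬(i ∈ T ∧ j ∈ T) → M i j = N i j) : M = N := by
  ext i j
  obtain ⟨c, hc⟩ := hMT.exists_coeff i
  obtain ⟨d, hd⟩ := hNT.exists_coeff j
  calc M i j = ∑ k ∈ Tᶜ, c k * ∑ l ∈ Tᶜ, d l * M k l := by
        rw [hc]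
        refine Finset.sum_congr rfl fun k hk => ?_
        have hk : k ∉ T := by simpa using hk
        rw [h k j (by tauto), hN.apply, hd]
        congr 1
        refine Finset.sum_congr rfl fun l _ => ?_
        rw [hN.apply, h k l (by tauto)]
    _ = ∑ l ∈ Tᶜ, d l * ∑ k ∈ Tᶜ, c k * M k l := by
        simp_rw [Finset.mul_sum]
        rw [Finset.sum_comm]
        exact Finset.sum_congr rfl fun l _ => Finset.sum_congr rfl fun k _ => by ring
    _ = N i j := by
        rw [← hN.apply i j, hd]
        refine Finset.sum_congr rfl fun l hl => ?_
        have hl : l ∉ T := by simpa using hl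
        rw [← hc, h i l (by tauto), hN.apply]

theorem Matrix.card_isSymm_rowsSpannedOutside_le {n : ℕ} {K : Type*} [Field K] [Fintype K]
    (T : Finset (Fin n)) :
    (Finset.univ.filter fun M : Matrix (Fin n) (Fin n) K =>
      M.IsSymm ∧ M.RowsSpannedOutside T).card ≤
      Fintype.card K ^ ((n + 1).choose 2 - (T.card + 1).choose 2) := by
  have hcard : Fintype.card (↥(T.sym2ᶜ) → K) =
      Fintype.card K ^ ((n + 1).choose 2 - (T.card + 1).choose 2) := by
    rw [Fintype.card_fun, Fintype.card_coe, Finset.card_compl, Sym2.card, Finset.card_sym2,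
      Fintype.card_fin]
  rw [← hcard, ← Finset.card_univ]
  refine Finset.card_le_card_of_injOn
    (fun M (z : ↥(T.sym2ᶜ)) => M z.1.inf z.1.sup) (fun _ _ => Finset.mem_coe.2 (Finset.mem_univ _)) ?_
  intro M hM N hN hMN
  simp only [Finset.coe_filter, Finset.mem_univ, true_and] at hM hN
  refine hM.2.eq_of_eq_off_block hN.1 hN.2 fun i j hij => ?_
  have hz := congrFun hMN ⟨s(i, j), by rwa [Finset.mem_compl, Finset.mk_mem_sym2_iff]⟩
  rcases le_total i j with hle | hle
  · simpa [hle] using hz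
  · rw [← hM.1.apply, ← hN.1.apply]
    simpa [hle] using hz

theorem Matrix.card_isSymm_rank_le {n s : ℕ} (hs : s ≤ n) (K : Type*) [Field K] [Fintype K] :
    (Finset.univ.filter fun M : Matrix (Fin n) (Fin n) K => M.IsSymm ∧ M.rank ≤ n - s).card ≤
      n.choose s * Fintype.card K ^ ((n + 1).choose 2 - (s + 1).choose 2) := by
  calc _ ≤ ((Finset.powersetCard s Finset.univ).biUnion fun T =>
        Finset.univ.filter fun M : Matrix (Fin n) (Fin n) K =>
          M.IsSymm ∧ M.RowsSpannedOutside T).card := by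
        refine Finset.card_le_card fun M hM => ?_
        simp only [Finset.mem_filter, Finset.mem_univ, true_and] at hM
        obtain ⟨T, hT, hMT⟩ := M.exists_rowsSpannedOutside (s := s) (by simpa) (by simpa using hM.2)
        simp only [Finset.mem_biUnion, Finset.mem_powersetCard, Finset.subset_univ, true_and,
          Finset.mem_filter, Finset.mem_univ]
        exact ⟨T, hT, hM.1, hMT⟩
    _ ≤ (Finset.powersetCard s (Finset.univ : Finset (Fin n))).card *
          Fintype.card K ^ ((n + 1).choose 2 - (s + 1).choose 2) := by
        refine Finset.card_biUnion_le_card_mul _ _ _ fun T hT => ?_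
        rw [← (Finset.mem_powersetCard.1 hT).2]
        exact Matrix.card_isSymm_rowsSpannedOutside_le T
    _ = _ := by rw [Finset.card_powersetCard, Finset.card_univ, Fintype.card_fin]

/-- For every `n ≥ 1` and every `0 ≤ s ≤ n`, the number of symmetric `n × n` matrices
over `F_2` with rank at most `n - s` is at most `2^{C(n,2)+n} · n^s · 2^{-C(s,2)}`.
Equivalently, a uniformly random symmetric matrix in `Sym_n(F_2)` (which has cardinality
`2^{C(n,2)+n}`) has rank at most `n - s` with probability at most `n^s · 2^{-C(s,2)}`. -/
theorem symmetric_rank_tail (n s : ℕ) (hn : 1 ≤ n) (hs : s ≤ n) :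
    ((Finset.univ.filter (fun M : Matrix (Fin n) (Fin n) (ZMod 2) =>
        M.IsSymm ∧ M.rank ≤ n - s)).card : ℝ) ≤
      2 ^ (n.choose 2 + n) * (n : ℝ) ^ s * ((2 : ℝ) ^ s.choose 2)⁻¹ := by
  have hchoose : ∀ m : ℕ, (m + 1).choose 2 = m.choose 2 + m := fun m => by
    rw [Nat.choose_succ_succ' m 1, Nat.choose_one_right, add_comm]
  have hexp : (n + 1).choose 2 - (s + 1).choose 2 + s.choose 2 ≤ n.choose 2 + n := by
    have := Nat.choose_le_choose 2 (Nat.add_le_add_right hs 1)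
    rw [hchoose, hchoose] at *
    omega
  rw [← div_eq_mul_inv, le_div_iff₀ (by positivity)]
  norm_cast
  calc _ ≤ n.choose s * 2 ^ ((n + 1).choose 2 - (s + 1).choose 2) * 2 ^ s.choose 2 := by
        gcongr
        have hcard := Matrix.card_isSymm_rank_le hs (ZMod 2)
        rw [ZMod.card] at hcard
        refine le_of_eq_of_le ?_ hcard
        congr!
    _ = n.choose s * 2 ^ ((n + 1).choose 2 - (s + 1).choose 2 + s.choose 2) := by
        rw [mul_assoc, ← pow_add]
    _ ≤ n ^ s * 2 ^ (n.choose 2 + n) := by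
        gcongr
        · exact Nat.choose_le_pow n s
        · norm_num
    _ = _ := mul_comm _ _
end

section
/- Let n ≥ 4 and 2 ≤ k ≤ n − 2 with k ≡ 2 (mod 4). Then H_k, the F_2-span of the clique vectors {v_X : X ⊆ [n], |X| = k}, equals all of F_2^{C(n,2)}. -/
open scoped BigOperators

/-- `H_k`: the `F_2`-linear span of the clique vectors `{v_X : X ⊆ [n], |X| = k}`. -/
def Hk (n k : ℕ) : Submodule (ZMod 2) (PairIdx n → ZMod 2) :=
  Submodule.span (ZMod 2) {v | ∃ X : Finset (Fin n), X.card = k ∧ cliqueVec n X = v}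

/-- The edge-count parity map `e : F_2^{C(n,2)} → F_2`, `e(F) = |F| mod 2`. -/
def eMap (n : ℕ) : (PairIdx n → ZMod 2) →ₗ[ZMod 2] ZMod 2 :=
  ∑ p : PairIdx n, LinearMap.proj p

/-- The degree-parity map `∂ : F_2^{C(n,2)} → F_2^n`, `∂(F)_v = deg_F(v) mod 2`. -/
def dMap (n : ℕ) : (PairIdx n → ZMod 2) →ₗ[ZMod 2] (Fin n → ZMod 2) :=
  LinearMap.pi fun v =>
    ∑ p ∈ Finset.univ.filter (fun p : PairIdx n => p.1.1 = v ∨ p.1.2 = v),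
      LinearMap.proj p

/-- The characteristic vector of the single edge `{a, b}`. -/
def edgeVec (n : ℕ) (a b : Fin n) : PairIdx n → ZMod 2 :=
  fun p => if (p.1.1 = a ∧ p.1.2 = b) ∨ (p.1.1 = b ∧ p.1.2 = a) then 1 else 0

theorem edgeVec_comm (n : ℕ) (a b : Fin n) : edgeVec n a b = edgeVec n b a := by
  funext p
  simp only [edgeVec, or_comm]

theorem edgeVec_eq_single (n : ℕ) (p : PairIdx n) :
    edgeVec n p.1.1 p.1.2 = Pi.single p 1 := by
  funext q
  have key : ((q.1.1 = p.1.1 ∧ q.1.2 = p.1.2) ∨ (q.1.1 = p.1.2 ∧ q.1.2 = p.1.1)) ↔ q = p := by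
    constructor
    · rintro (⟨h1, h2⟩ | ⟨h1, h2⟩)
      · exact Subtype.ext (Prod.ext h1 h2)
      · exact absurd p.2 (lt_asymm (h1 ▸ h2 ▸ q.2))
    · rintro rfl
      exact Or.inl ⟨rfl, rfl⟩
  simp only [edgeVec, Pi.single_apply, key]

theorem cliqueVec_empty (n : ℕ) : cliqueVec n ∅ = 0 := by
  funext p
  simp [cliqueVec]

theorem cliqueVec_insert (n : ℕ) (a : Fin n) (Y : Finset (Fin n)) (ha : a ∉ Y) :
    cliqueVec n (insert a Y) = cliqueVec n Y + ∑ y ∈ Y, edgeVec n a y := by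
  funext p
  have hne : p.1.1 ≠ p.1.2 := ne_of_lt p.2
  simp only [cliqueVec, edgeVec, Pi.add_apply, Finset.sum_apply, Finset.mem_insert]
  generalize p.1.1 = x at *
  generalize p.1.2 = z at *
  by_cases hx : x = a
  · subst hx
    simp [ha, hne.symm]
  · by_cases hz : z = a
    · subst hz
      simp [ha, hx]
    · simp [hx, hz]

theorem map_cliqueVec_insert {n : ℕ} (φ : (PairIdx n → ZMod 2) →ₗ[ZMod 2] ZMod 2)
    {a : Fin n} {Y : Finset (Fin n)} (ha : a ∉ Y) :
    φ (cliqueVec n (insert a Y)) = φ (cliqueVec n Y) + ∑ y ∈ Y, φ (edgeVec n a y) := by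
  rw [cliqueVec_insert n a Y ha, map_add, map_sum]

/-- A functional vanishing on all `k`-cliques vanishes on all 4-cycles. -/
theorem fourCycle_eq_zero {n k : ℕ} (hk2 : 2 ≤ k) (hkn : k + 2 ≤ n)
    (φ : (PairIdx n → ZMod 2) →ₗ[ZMod 2] ZMod 2)
    (hφ : ∀ X : Finset (Fin n), X.card = k → φ (cliqueVec n X) = 0)
    {a b c d : Fin n} (hab : a ≠ b) (hac : a ≠ c) (had : a ≠ d) (hbc : b ≠ c)
    (hbd : b ≠ d) (hcd : c ≠ d) :
    φ (edgeVec n a c) + φ (edgeVec n a d) + φ (edgeVec n b c) + φ (edgeVec n b d) = 0 := by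
  have hcard : ({a, b, c, d} : Finset (Fin n)).card = 4 := by
    simp [Finset.card_insert_of_notMem, *]
  obtain ⟨Y, hY, hYk⟩ := Finset.exists_subset_card_eq
    (s := ({a, b, c, d} : Finset (Fin n))ᶜ) (n := k - 2)
    (by rw [Finset.card_compl, hcard, Fintype.card_fin]; omega)
  have hout : a ∉ Y ∧ b ∉ Y ∧ c ∉ Y ∧ d ∉ Y := by
    refine ⟨?_, ?_, ?_, ?_⟩ <;> intro h <;> simpa using hY h
  obtain ⟨ha, hb, hc, hd⟩ := hout
  have key : ∀ x y : Fin n, x ≠ y → x ∉ Y → y ∉ Y →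
      φ (cliqueVec n Y) + ∑ z ∈ Y, φ (edgeVec n y z) +
        (φ (edgeVec n x y) + ∑ z ∈ Y, φ (edgeVec n x z)) = 0 := by
    intro x y hxy hx hy
    have hx' : x ∉ insert y Y := by simp [hxy, hx]
    rw [← map_cliqueVec_insert φ hy, ← Finset.sum_insert (f := fun z => φ (edgeVec n x z)) hy, ← map_cliqueVec_insert φ hx']
    apply hφ
    rw [Finset.card_insert_of_notMem hx', Finset.card_insert_of_notMem hy]
    omega
  have h2 : (2 : ZMod 2) = 0 := rfl
  linear_combination key a c hac ha hc + key a d had ha hd + key b c hbc hb hc +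
    key b d hbd hb hd - (2 * φ (cliqueVec n Y) + ∑ z ∈ Y, φ (edgeVec n a z) +
      ∑ z ∈ Y, φ (edgeVec n b z) + ∑ z ∈ Y, φ (edgeVec n c z) +
      ∑ z ∈ Y, φ (edgeVec n d z)) * h2

/-- A functional vanishing on all 4-cycles is a vertex potential plus a constant. -/
theorem exists_potential {n : ℕ} (hn : 4 ≤ n) (g : Fin n → Fin n → ZMod 2)
    (hsymm : ∀ a b, g a b = g b a)
    (hcycle : ∀ a b c d, a ≠ b → a ≠ c → a ≠ d → b ≠ c → b ≠ d → c ≠ d →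
      g a c + g a d + g b c + g b d = 0) :
    ∃ (f : Fin n → ZMod 2) (t : ZMod 2), ∀ x y, x ≠ y → g x y = f x + f y + t := by
  have h2 : (2 : ZMod 2) = 0 := rfl
  let u : Fin n := ⟨0, by omega⟩
  let v : Fin n := ⟨1, by omega⟩
  let w : Fin n := ⟨2, by omega⟩
  have huv : u ≠ v := by simp [u, v]
  have huw : u ≠ w := by simp [u, w]
  have hvw : v ≠ w := by simp [v, w]
  let T : Fin n → Fin n → ZMod 2 := fun x y => g x y + g u x + g u y
  have hTsymm : ∀ x y, T x y = T y x := fun x y => by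
    simp only [T, hsymm x y]; ring
  have hT : ∀ x y z, u ≠ x → u ≠ y → u ≠ z → x ≠ y → x ≠ z → T x y = T x z := by
    intro x y z hx hy hz hxy hxz
    by_cases hyz : y = z
    · rw [hyz]
    · have := hcycle x u y z hx.symm hxy hxz hy hz hyz
      simp only [T]
      linear_combination this - (g x z + g u z) * h2
  have hconst : ∀ x y, u ≠ x → u ≠ y → x ≠ y → T x y = T v w := by
    intro x y hx hy hxy
    by_cases hxv : x = v
    · subst hxv
      exact hT _ _ _ huv hy huw hxy hvw
    · rw [hT x y v hx hy huv hxy hxv, hTsymm, hT v x w huv hx huw (Ne.symm hxv) hvw]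
  refine ⟨fun x => if x = u then T v w else g u x, T v w, fun x y hxy => ?_⟩
  by_cases hx : x = u
  · subst hx
    simp only [if_true, if_neg hxy.symm]
    linear_combination -T v w * h2
  · by_cases hy : y = u
    · subst hy
      simp only [if_true, if_neg hxy, hsymm x u]
      linear_combination -T v w * h2
    · have := hconst x y (Ne.symm hx) (Ne.symm hy) hxy
      simp only [if_neg hx, if_neg hy, ← this, T]
      linear_combination -(g u x + g u y) * h2

theorem map_cliqueVec_add_sum {n : ℕ} (φ : (PairIdx n → ZMod 2) →ₗ[ZMod 2] ZMod 2)
    (f : Fin n → ZMod 2) (t : ZMod 2)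
    (hf : ∀ x y, x ≠ y → φ (edgeVec n x y) = f x + f y + t) (X : Finset (Fin n)) :
    φ (cliqueVec n X) + ∑ x ∈ X, f x = X.card * ∑ x ∈ X, f x + (X.card.choose 2 : ℕ) * t := by
  have h2 : (2 : ZMod 2) = 0 := rfl
  induction X using Finset.induction_on with
  | empty => simp [cliqueVec_empty]
  | insert a Y ha ih =>
    have hsum : ∑ y ∈ Y, φ (edgeVec n a y) = Y.card * f a + ∑ y ∈ Y, f y + Y.card * t := by
      rw [Finset.sum_congr rfl fun y hy => hf a y (by rintro rfl; exact ha hy)]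
      simp [Finset.sum_add_distrib]
    rw [map_cliqueVec_insert φ ha, Finset.card_insert_of_notMem ha, Finset.sum_insert ha, hsum,
      Nat.choose_succ_succ' Y.card 1, Nat.choose_one_right]
    push_cast
    linear_combination ih

/-- For `n ≥ 4`, `2 ≤ k ≤ n - 2` and `k ≡ 2 (mod 4)`, the span `H_k` of the `k`-clique
vectors is all of `F_2^{C(n,2)}`. -/
theorem Hk_eq_top (n k : ℕ) (hn : 4 ≤ n) (hk2 : 2 ≤ k) (hkn : k ≤ n - 2)
    (hmod : k % 4 = 2) : Hk n k = ⊤ := by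
  have h2 : (2 : ZMod 2) = 0 := rfl
  by_contra hne
  obtain ⟨φ, hφ0, hle⟩ := Submodule.exists_le_ker_of_lt_top _ (lt_top_iff_ne_top.mpr hne)
  have hφ : ∀ X : Finset (Fin n), X.card = k → φ (cliqueVec n X) = 0 := fun X hX =>
    hle (Submodule.subset_span ⟨X, hX, rfl⟩)
  obtain ⟨f, t, hf⟩ := exists_potential hn (fun a b => φ (edgeVec n a b))
    (fun a b => by simp only [edgeVec_comm n a b])
    (fun a b c d hab hac had hbc hbd hcd =>
      fourCycle_eq_zero hk2 (by omega) φ hφ hab hac had hbc hbd hcd)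
  have hkz : (k : ZMod 2) = 0 := (ZMod.natCast_eq_zero_iff k 2).mpr (by omega)
  have hchoose : ((k.choose 2 : ℕ) : ZMod 2) = 1 := by
    obtain ⟨j, rfl⟩ : ∃ j, k = 4 * j + 2 := ⟨k / 4, by omega⟩
    have : (4 * j + 2).choose 2 = 2 * (4 * j ^ 2 + 3 * j) + 1 := by
      rw [Nat.choose_two_right]
      apply Nat.div_eq_of_eq_mul_left two_pos
      rw [show 4 * j + 2 - 1 = 4 * j + 1 by omega]
      ring
    rw [this]
    push_cast
    linear_combination (4 * (j : ZMod 2) ^ 2 + 3 * j) * h2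
  have hsum : ∀ X : Finset (Fin n), X.card = k → ∑ x ∈ X, f x = t := by
    intro X hX
    have h := map_cliqueVec_add_sum φ f t hf X
    rw [hφ X hX, hX, hkz, hchoose] at h
    linear_combination h
  have hconst : ∀ a b, f a = f b := by
    intro a b
    by_cases hab : a = b
    · rw [hab]
    obtain ⟨Y, hY, hYk⟩ := Finset.exists_subset_card_eq
      (s := ({a, b} : Finset (Fin n))ᶜ) (n := k - 1)
      (by rw [Finset.card_compl, Finset.card_pair hab, Fintype.card_fin]; omega)
    have ha : a ∉ Y := fun h => by simpa using hY h
    have hb : b ∉ Y := fun h => by simpa using hY h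
    have h1 := hsum (insert a Y) (by rw [Finset.card_insert_of_notMem ha]; omega)
    have h3 := hsum (insert b Y) (by rw [Finset.card_insert_of_notMem hb]; omega)
    rw [Finset.sum_insert ha] at h1
    rw [Finset.sum_insert hb] at h3
    linear_combination h1 - h3
  have ht : t = 0 := by
    obtain ⟨X, -, hX⟩ := Finset.exists_subset_card_eq
      (s := (Finset.univ : Finset (Fin n))) (n := k) (by simp; omega)
    rw [← hsum X hX, Finset.sum_congr rfl fun x _ => hconst x ⟨0, by omega⟩]
    simp [hX, hkz]
  apply hφ0
  refine LinearMap.pi_ext' fun p => LinearMap.ext_ring ?_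
  have h := hf p.1.1 p.1.2 (ne_of_lt p.2)
  rw [edgeVec_eq_single, hconst p.1.1 p.1.2, ht] at h
  simp only [LinearMap.comp_apply, LinearMap.single_apply, LinearMap.zero_apply]
  linear_combination h + f p.1.2 * h2
end
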